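/- arXiv:math/0608189 — 3 statements merged into one kernel-verified Lean document; each statement's English description precedes it below -/
import Mathlib

section
/- Assume K satisfies (K1). Then for every r>0 one has p·r·K(r)^{1/p} ≥ (p + r·K'(r)/K(r))·∫₀^r K(τ)^{1/p} dτ, the integral on the right-hand side being finite. -/
open Set Filter Topology MeasureTheory
open scoped ENNReal NNReal

noncomputable section

/-- `φ_p(s) = |s|^{p-2} s` (with the convention `φ_p(0)=0`). -/
def phiP (p s : ℝ) : ℝ := |s| ^ (p - 2) * s

/-- `K` is strictly positive and `C¹` on `(0,∞)` and satisfies condition (K1):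
the map `r ↦ p + r·K'(r)/K(r)` is strictly positive and decreasing on `(0,∞)`. -/
def CondK1 (p : ℝ) (K : ℝ → ℝ) : Prop :=
  (∀ r : ℝ, 0 < r → 0 < K r) ∧ ContDiffOn ℝ 1 K (Ioi 0) ∧
  (∀ r : ℝ, 0 < r → 0 < p + r * deriv K r / K r) ∧
  AntitoneOn (fun r => p + r * deriv K r / K r) (Ioi 0)

/-- (f1): `f(0)=0`, `f>0` above `u₀`, `f≤0` and not identically `0` on `(0,u₀)`. -/
def CondF1 (f : ℝ → ℝ) (u₀ : ℝ) : Prop :=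
  f 0 = 0 ∧ (∀ v : ℝ, u₀ < v → 0 < f v) ∧ (∀ v ∈ Ioo 0 u₀, f v ≤ 0) ∧
  ∃ v ∈ Ioo 0 u₀, f v ≠ 0

/-- (f2): `f` is continuous on `[0,∞)` and locally Lipschitz on `[u₀,∞)`. -/
def CondF2 (f : ℝ → ℝ) (u₀ : ℝ) : Prop :=
  ContinuousOn f (Ici 0) ∧ LocallyLipschitzOn (Ici u₀) f

/-- `D`: the set of differentiability points of `f` within `[u₀,∞)`. -/
def Dset (f : ℝ → ℝ) (u₀ : ℝ) : Set ℝ :=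
  {v | v ∈ Ici u₀ ∧ DifferentiableWithinAt ℝ f (Ici u₀) v}

/-- the (one-sided) derivative `f'` of `f` on `[u₀,∞)`. -/
def fder (f : ℝ → ℝ) (u₀ : ℝ) (v : ℝ) : ℝ := derivWithin f (Ici u₀) v

/-- (f3): `(p-1)f(u) ≤ f'(u)(u-u₀)` on `D`. -/
def CondF3 (p : ℝ) (f : ℝ → ℝ) (u₀ : ℝ) : Prop :=
  ∀ v ∈ Dset f u₀, (p - 1) * f v ≤ fder f u₀ v * (v - u₀)

/-- (f4): `u ↦ u·f'(u)/f(u)` is decreasing on `D`. -/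
def CondF4 (f : ℝ → ℝ) (u₀ : ℝ) : Prop :=
  AntitoneOn (fun v => v * fder f u₀ v / f v) (Dset f u₀)

/-- `u` is a solution of the radial equation
`(r^{n-1} φ_p(u'))' = -r^{n-1} K(r) f(u)` on the interval `I ⊆ [0,∞)`, `0 ∈ I`:
`u ∈ C¹(I)`, `r ↦ r^{n-1} φ_p(u'(r))` is `C¹` on `I` and the equation holds for `r ∈ I`, `r>0`. -/
def IsRadialSolution (p : ℝ) (n : ℕ) (K f : ℝ → ℝ) (I : Set ℝ) (u : ℝ → ℝ) : Prop :=
  (0:ℝ) ∈ I ∧ I ⊆ Ici 0 ∧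
  ContDiffOn ℝ 1 u I ∧
  ContDiffOn ℝ 1 (fun r => r ^ (n - 1) * phiP p (derivWithin u I r)) I ∧
  ∀ r ∈ I, 0 < r →
    HasDerivWithinAt (fun r => r ^ (n - 1) * phiP p (derivWithin u I r))
      (-(r ^ (n - 1) * K r * f (u r))) I r

/-- `F(s) = ∫₀^s f(t) dt`. -/
def Fint (f : ℝ → ℝ) (s : ℝ) : ℝ := ∫ t in (0:ℝ)..s, f t

/-- `r ↦ p·r·K(r)^{1/p}` is an antiderivative of `(p + r·K'(r)/K(r))·K(r)^{1/p}`. -/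
theorem hasDerivAt_mul_rpow_one_div {p : ℝ} (hp : p ≠ 0) {K : ℝ → ℝ} {t : ℝ} (ht : 0 < K t)
    (hd : DifferentiableAt ℝ K t) :
    HasDerivAt (fun r => p * r * K r ^ (1 / p))
      ((p + t * deriv K t / K t) * K t ^ (1 / p)) t := by
  have h := ((hasDerivAt_id t).const_mul p).mul
    (hd.hasDerivAt.rpow_const (p := 1 / p) (Or.inl ht.ne'))
  refine h.congr_deriv ?_
  rw [Real.rpow_sub_one ht.ne']
  simp only [id]
  field_simp

/-- The inequality on `[a, r]` with `0 < a`, where all integrands are continuous. -/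
theorem CondK1.mul_setIntegral_Ioc_le {p : ℝ} (hp : 0 < p) {K : ℝ → ℝ} (hK : CondK1 p K)
    {a r : ℝ} (ha : 0 < a) (har : a ≤ r) :
    IntegrableOn (fun τ => K τ ^ (1 / p)) (Ioc a r) volume ∧
      (p + r * deriv K r / K r) * ∫ τ in Ioc a r, K τ ^ (1 / p) ≤
        p * r * K r ^ (1 / p) := by
  obtain ⟨hpos, hC, -, hanti⟩ := hK
  have hsub : Icc a r ⊆ Ioi 0 := fun x hx => ha.trans_le hx.1
  have hd : ∀ t ∈ Ioi (0 : ℝ), DifferentiableAt ℝ K t := fun t ht =>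
    (hC.differentiableOn one_ne_zero).differentiableAt (Ioi_mem_nhds ht)
  have hcK : ContinuousOn K (Icc a r) := hC.continuousOn.mono hsub
  have hcd : ContinuousOn (deriv K) (Icc a r) :=
    (hC.continuousOn_deriv_of_isOpen isOpen_Ioi le_rfl).mono hsub
  have hcf : ContinuousOn (fun τ => K τ ^ (1 / p)) (Icc a r) :=
    hcK.rpow_const fun x hx => Or.inl (hpos x (hsub hx)).ne'
  have hcg : ContinuousOn (fun t => (p + t * deriv K t / K t) * K t ^ (1 / p)) (Icc a r) :=
    (continuousOn_const.add ((continuousOn_id.mul hcd).div hcK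
      fun x hx => (hpos x (hsub hx)).ne')).mul hcf
  have hif := hcf.intervalIntegrable_of_Icc (μ := volume) har
  have hig := hcg.intervalIntegrable_of_Icc (μ := volume) har
  refine ⟨(intervalIntegrable_iff_integrableOn_Ioc_of_le har).1 hif, ?_⟩
  rw [← intervalIntegral.integral_of_le har, ← intervalIntegral.integral_const_mul]
  calc ∫ t in a..r, (p + r * deriv K r / K r) * K t ^ (1 / p)
      ≤ ∫ t in a..r, (p + t * deriv K t / K t) * K t ^ (1 / p) := by
        refine intervalIntegral.integral_mono_on har (hif.const_mul _) hig fun t ht => ?_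
        exact mul_le_mul_of_nonneg_right (hanti (hsub ht) (ha.trans_le har) ht.2)
          (Real.rpow_nonneg (hpos t (hsub ht)).le _)
    _ = p * r * K r ^ (1 / p) - p * a * K a ^ (1 / p) :=
        intervalIntegral.integral_eq_sub_of_hasDerivAt (fun t ht => by
          rw [uIcc_of_le har] at ht
          exact hasDerivAt_mul_rpow_one_div hp.ne' (hpos t (hsub ht)) (hd t (hsub ht))) hig
    _ ≤ p * r * K r ^ (1 / p) :=
        sub_le_self _ (mul_nonneg (mul_pos hp ha).le (Real.rpow_nonneg (hpos a ha).le _))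

/-- Under (K1): `p·r·K(r)^{1/p} ≥ (p + rK'(r)/K(r))·∫₀^r K(τ)^{1/p} dτ`,
the integral being finite. -/
theorem K_onep_integral_inequality
    (p : ℝ) (hp : 1 < p)
    (K : ℝ → ℝ) (hK : CondK1 p K) :
    ∀ r : ℝ, 0 < r →
      IntegrableOn (fun τ => K τ ^ (1 / p)) (Ioc 0 r) volume ∧
      (p + r * deriv K r / K r) * ∫ τ in Ioc (0:ℝ) r, K τ ^ (1 / p) ≤
        p * r * K r ^ (1 / p) := by
  intro r hr
  have hp0 : 0 < p := one_pos.trans hp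
  let a : ℕ → ℝ := fun n => r / ((n : ℝ) + 1)
  have ha : ∀ n, 0 < a n := fun n => by positivity
  have har : ∀ n, a n ≤ r := fun n =>
    div_le_self hr.le (le_add_of_nonneg_left n.cast_nonneg)
  have hlim : Tendsto a atTop (𝓝 0) := by
    simpa [a, div_eq_mul_inv] using
      (tendsto_one_div_add_atTop_nhds_zero_nat (𝕜 := ℝ)).const_mul r
  have key := fun n => hK.mul_setIntegral_Ioc_le hp0 (ha n) (har n)
  have hA : 0 < p + r * deriv K r / K r := hK.2.2.1 r hr
  have hint : IntegrableOn (fun τ => K τ ^ (1 / p)) (Ioc 0 r) volume := by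
    refine integrableOn_Ioc_of_intervalIntegral_norm_bounded_left
      (I := p * r * K r ^ (1 / p) / (p + r * deriv K r / K r)) (fun n => (key n).1) hlim
      (Eventually.of_forall fun n => ?_)
    rw [le_div_iff₀' hA, setIntegral_congr_fun (g := fun τ => K τ ^ (1 / p)) measurableSet_Ioc
      fun t ht => Real.norm_of_nonneg (Real.rpow_nonneg (hK.1 t ((ha n).trans ht.1)).le _)]
    exact (key n).2
  refine ⟨hint, le_of_tendsto' (x := atTop) (Tendsto.const_mul _ ?_) fun n => (key n).2⟩
  have h := (aecover_Ioc_of_Ioc (μ := volume) hlim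
    (tendsto_const_nhds (x := r))).integral_tendsto_of_countably_generated hint
  refine h.congr fun n => ?_
  rw [Measure.restrict_restrict measurableSet_Ioc,
    inter_eq_left.2 (Ioc_subset_Ioc_left (ha n).le)]
end
end

section
/- Assume K satisfies (K1) and f satisfies (f1) and (f2). If ᾱ ∈ G∪N then the energy E(r,ᾱ) := |u'(r,ᾱ)|^p/(p'·K(r)) + F(u(r,ᾱ)) is strictly positive for every r ∈ (0,R(ᾱ)); moreover, if ᾱ ∈ G then lim_{r→R(ᾱ)} E(r,ᾱ) = 0. -/
open Set Filter Topology MeasureTheory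
open scoped ENNReal NNReal

noncomputable section

/-- the derivative `u'` of a solution defined on `[0,∞)` (one-sided at `0`). -/
def uderiv (u : ℝ → ℝ) : ℝ → ℝ := derivWithin u (Ici 0)

/-- `R(α) = sup {r>0 : u(t,α)>0 and u'(t,α)<0 for all t ∈ (0,r)}`,
as an extended nonnegative real (it may be `∞`). -/
def Rend (u : ℝ → ℝ) : ℝ≥0∞ :=
  sSup {R : ℝ≥0∞ | ∀ t : ℝ, 0 < t → ENNReal.ofReal t < R → 0 < u t ∧ uderiv u t < 0}

/-- the filter describing the approach `r → R⁻` to the right endpoint `R`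
(`r → ∞` when `R = ∞`). -/
def endFilter (R : ℝ≥0∞) : Filter ℝ :=
  if R = ⊤ then atTop else 𝓝[<] R.toReal

/-- `u : α ↦ u(·,α)` is the family of solutions of the initial value problems
(`u(0,α)=α`, `u'(0,α)=0`) for `α > u₀`, depending continuously on `(α,r)`
together with its derivative. -/
def IsFamily (p : ℝ) (n : ℕ) (K f : ℝ → ℝ) (u₀ : ℝ) (u : ℝ → ℝ → ℝ) : Prop :=
  (∀ α : ℝ, u₀ < α →
    IsRadialSolution p n K f (Ici 0) (u α) ∧ u α 0 = α ∧ uderiv (u α) 0 = 0) ∧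
  ContinuousOn (fun q : ℝ × ℝ => u q.1 q.2) (Ioi u₀ ×ˢ Ici 0) ∧
  ContinuousOn (fun q : ℝ × ℝ => uderiv (u q.1) q.2) (Ioi u₀ ×ˢ Ici 0)

/-- the set `N` of initial values of crossing solutions; here `uR α` denotes the
limiting value `u(R(α),α)`. -/
def Ncross (u : ℝ → ℝ → ℝ) (uR : ℝ → ℝ) (u₀ : ℝ) : Set ℝ :=
  {α | u₀ < α ∧ uR α = 0 ∧
    ∃ L : ℝ, L < 0 ∧ Tendsto (uderiv (u α)) (endFilter (Rend (u α))) (𝓝 L)}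

/-- the set `G` of initial values of ground state solutions. -/
def Gset (u : ℝ → ℝ → ℝ) (uR : ℝ → ℝ) (u₀ : ℝ) : Set ℝ :=
  {α | u₀ < α ∧ uR α = 0 ∧
    Tendsto (uderiv (u α)) (endFilter (Rend (u α))) (𝓝 0)}

/-- the set `P` of initial values of positive solutions. -/
def Pset (uR : ℝ → ℝ) (u₀ : ℝ) : Set ℝ := {α | u₀ < α ∧ 0 < uR α}

/-- `t(s,α)`: the first point at which the solution `u(·,α)` takes the value `s`
(the unique `r ∈ [0,R(α))` with `u(r,α)=s` when `s` is attained there). -/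
def tInv (u : ℝ → ℝ) (s : ℝ) : ℝ := sInf {r : ℝ | 0 ≤ r ∧ u r = s}

/-- The energy `|u'|^p / (p' K) + F(u)` of a radial function `u`. -/
def radialEnergy (p : ℝ) (K f u : ℝ → ℝ) (r : ℝ) : ℝ :=
  |uderiv u r| ^ p / ((p / (p - 1)) * K r) + Fint f (u r)

theorem Fint_hasDerivAt {f : ℝ → ℝ} (hf : ContinuousOn f (Ici 0)) {v : ℝ} (hv : 0 < v) :
    HasDerivAt (Fint f) (f v) v := by
  have hint : IntervalIntegrable f volume 0 v :=
    (hf.mono (by rw [uIcc_of_le hv.le]; exact Icc_subset_Ici_self)).intervalIntegrable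
  have hc : ContinuousOn f (Ioi 0) := hf.mono Ioi_subset_Ici_self
  exact intervalIntegral.integral_hasDerivAt_right hint
    (hc.stronglyMeasurableAtFilter isOpen_Ioi v hv) (hc.continuousAt (Ioi_mem_nhds hv))

theorem Fint_tendsto_zero {f : ℝ → ℝ} (hf : ContinuousOn f (Ici 0)) :
    Tendsto (Fint f) (𝓝[>] 0) (𝓝 0) := by
  have hint : IntegrableOn f (uIcc 0 1) volume := by
    rw [uIcc_of_le zero_le_one]
    exact (hf.mono Icc_subset_Ici_self).integrableOn_Icc
  have h := (intervalIntegral.continuousOn_primitive_interval hint) 0 left_mem_uIcc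
  have h0 : Fint f 0 = 0 := by simp [Fint]
  rw [ContinuousWithinAt, uIcc_of_le zero_le_one] at h
  change Tendsto (Fint f) _ (𝓝 (Fint f 0)) at h
  rw [h0] at h
  refine h.mono_left ?_
  rw [← nhdsWithin_Ioo_eq_nhdsGT (zero_lt_one' ℝ)]
  exact nhdsWithin_mono _ Ioo_subset_Icc_self

theorem lt_Rend {u : ℝ → ℝ} {r : ℝ} (hr : 0 < r) (h : ENNReal.ofReal r < Rend u) :
    0 < u r ∧ uderiv u r < 0 := by
  obtain ⟨R, hR, hrR⟩ := lt_sSup_iff.1 h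
  exact hR r hr hrR

theorem eventually_endFilter {R : ℝ≥0∞} {a : ℝ} (ha : 0 ≤ a) (h : ENNReal.ofReal a < R) :
    ∀ᶠ s in endFilter R, a < s ∧ ENNReal.ofReal s < R := by
  unfold endFilter
  split_ifs with hR
  · filter_upwards [eventually_gt_atTop a] with s hs
    exact ⟨hs, hR ▸ ENNReal.ofReal_lt_top⟩
  · have ha' : a < R.toReal := (ENNReal.ofReal_lt_iff_lt_toReal ha hR).1 h
    filter_upwards [Ioo_mem_nhdsLT ha'] with s hs
    exact ⟨hs.1, (ENNReal.ofReal_lt_iff_lt_toReal (ha.trans hs.1.le) hR).2 hs.2⟩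

theorem endFilter_neBot (R : ℝ≥0∞) : (endFilter R).NeBot := by
  unfold endFilter
  split_ifs <;> infer_instance

section Solution

variable {p : ℝ} {n : ℕ} {K f u : ℝ → ℝ}

theorem IsRadialSolution.hasDerivAt (hu : IsRadialSolution p n K f (Ici 0) u) {r : ℝ}
    (hr : 0 < r) : HasDerivAt u (uderiv u r) r :=
  ((hu.2.2.1.differentiableOn one_ne_zero r hr.le).hasDerivWithinAt).hasDerivAt (Ici_mem_nhds hr)

theorem IsRadialSolution.continuousOn_uderiv (hu : IsRadialSolution p n K f (Ici 0) u) :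
    ContinuousOn (uderiv u) (Ici 0) :=
  hu.2.2.1.continuousOn_derivWithin (uniqueDiffOn_Ici 0) le_rfl

theorem neg_phiP {s : ℝ} (hs : s < 0) : -phiP p s = (-s) ^ (p - 1) := by
  have h : (-s) ^ (p - 1) = (-s) ^ (p - 2) * (-s) := by
    rw [← Real.rpow_add_one (by linarith)]
    congr 1
    ring
  rw [h, phiP, abs_of_neg hs]
  ring

/-- The radial equation written for `|u'|^{p-1}` where `u' < 0`. -/
theorem IsRadialSolution.hasDerivAt_rpow (hu : IsRadialSolution p n K f (Ici 0) u)
    (hn : 1 ≤ n) {r : ℝ} (hr : 0 < r) (hd : uderiv u r < 0) :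
    HasDerivAt (fun s => (-uderiv u s) ^ (p - 1))
      (K r * f (u r) - ((n : ℝ) - 1) / r * (-uderiv u r) ^ (p - 1)) r := by
  have hg : HasDerivAt (fun s => s ^ (n - 1) * phiP p (uderiv u s))
      (-(r ^ (n - 1) * K r * f (u r))) r :=
    (hu.2.2.2.2 r hr.le hr).hasDerivAt (Ici_mem_nhds hr)
  have hpow : HasDerivAt (fun s : ℝ => s ^ (n - 1)) (((n : ℝ) - 1) / r * r ^ (n - 1)) r := by
    refine (hasDerivAt_pow (n - 1) r).congr_deriv ?_
    obtain ⟨k, rfl⟩ := Nat.exists_eq_add_of_le' hn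
    rcases k with _ | k
    · simp
    · simp only [Nat.add_sub_cancel]
      push_cast
      field_simp
      ring
  have hr0 : r ^ (n - 1) ≠ 0 := (pow_pos hr _).ne'
  have hq := (hg.div hpow hr0).neg
  have heq : (fun s => (-uderiv u s) ^ (p - 1)) =ᶠ[𝓝 r]
      -((fun s => s ^ (n - 1) * phiP p (uderiv u s)) / fun s => s ^ (n - 1)) := by
    have hc : ContinuousAt (uderiv u) r := hu.continuousOn_uderiv.continuousAt (Ici_mem_nhds hr)
    filter_upwards [hc.eventually_lt_const hd, lt_mem_nhds hr] with s hs hs0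
    have : s ^ (n - 1) ≠ 0 := (pow_pos hs0 _).ne'
    simp only [Pi.neg_apply, Pi.div_apply, ← neg_phiP hs]
    field_simp
  refine (hq.congr_of_eventuallyEq heq).congr_deriv ?_
  rw [← neg_phiP hd]
  field_simp
  ring

theorem IsRadialSolution.hasDerivAt_radialEnergy (hu : IsRadialSolution p n K f (Ici 0) u)
    (hp : 1 < p) (hn : 1 ≤ n) (hK : CondK1 p K) (hf : ContinuousOn f (Ici 0)) {r : ℝ}
    (hr : 0 < r) (hur : 0 < u r) (hd : uderiv u r < 0) :
    HasDerivAt (radialEnergy p K f u)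
      (-((-uderiv u r) ^ p / (r * K r) *
        (((n : ℝ) - 1) + (r * deriv K r / K r) * ((p - 1) / p)))) r := by
  have hp1 : p - 1 ≠ 0 := by linarith
  have hp0 : p ≠ 0 := by linarith
  have hw : 0 < -uderiv u r := by linarith
  have hKr := hK.1 r hr
  have hKd : HasDerivAt K (deriv K r) r :=
    ((hK.2.1.differentiableOn one_ne_zero).differentiableAt (Ioi_mem_nhds hr)).hasDerivAt
  have hF : HasDerivAt (fun s => Fint f (u s)) (f (u r) * uderiv u r) r :=
    (Fint_hasDerivAt hf hur).comp r (hu.hasDerivAt hr)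
  have hW := (hu.hasDerivAt_rpow hn hr hd).rpow_const (p := p / (p - 1))
    (Or.inl (Real.rpow_pos_of_pos hw _).ne')
  have hexp : ((-uderiv u r) ^ (p - 1)) ^ (p / (p - 1) - 1) = -uderiv u r := by
    rw [← Real.rpow_mul hw.le]
    have : (p - 1) * (p / (p - 1) - 1) = 1 := by field_simp; ring
    rw [this, Real.rpow_one]
  have hE := (hW.div (hKd.const_mul (p / (p - 1)))
    (mul_ne_zero (div_ne_zero hp0 hp1) hKr.ne')).add hF
  have heq : radialEnergy p K f u =ᶠ[𝓝 r]
      (((fun s => ((-uderiv u s) ^ (p - 1)) ^ (p / (p - 1))) / fun s => p / (p - 1) * K s) +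
        fun s => Fint f (u s)) := by
    have hc : ContinuousAt (uderiv u) r := hu.continuousOn_uderiv.continuousAt (Ici_mem_nhds hr)
    filter_upwards [hc.eventually_lt_const hd] with s hs
    simp only [Pi.add_apply, Pi.div_apply, radialEnergy, abs_of_neg hs]
    rw [← Real.rpow_mul (by linarith), mul_div_cancel₀ _ hp1]
  refine (hE.congr_of_eventuallyEq heq).congr_deriv ?_
  have hwp : ((-uderiv u r) ^ (p - 1)) ^ (p / (p - 1)) = (-uderiv u r) ^ (p - 1) * -uderiv u r := by
    rw [← Real.rpow_mul hw.le, mul_div_cancel₀ _ hp1, ← Real.rpow_add_one hw.ne']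
    simp
  have hwp' : (-uderiv u r) ^ p = (-uderiv u r) ^ (p - 1) * -uderiv u r := by
    rw [← Real.rpow_add_one hw.ne']
    simp
  rw [hexp, hwp, hwp']
  generalize (-uderiv u r) ^ (p - 1) = A
  field_simp
  ring

theorem IsRadialSolution.radialEnergy_strictAntiOn (hu : IsRadialSolution p n K f (Ici 0) u)
    (hp : 1 < p) (hn : p < n) (hK : CondK1 p K) (hf : ContinuousOn f (Ici 0)) :
    StrictAntiOn (radialEnergy p K f u) {r | 0 < r ∧ ENNReal.ofReal r < Rend u} := by
  have hn1 : 1 ≤ n := by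
    have : (1 : ℝ) < n := hp.trans hn
    exact_mod_cast this.le
  have hder : ∀ r ∈ {r | 0 < r ∧ ENNReal.ofReal r < Rend u}, _ := fun r hr =>
    hu.hasDerivAt_radialEnergy hp hn1 hK hf hr.1 (lt_Rend hr.1 hr.2).1 (lt_Rend hr.1 hr.2).2
  have hconv : Convex ℝ {r | 0 < r ∧ ENNReal.ofReal r < Rend u} :=
    OrdConnected.convex ⟨fun x hx y hy z hz =>
      ⟨hx.1.trans_le hz.1, (ENNReal.ofReal_le_ofReal hz.2).trans_lt hy.2⟩⟩
  refine strictAntiOn_of_deriv_neg hconv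
    (fun r hr => (hder r hr).continuousAt.continuousWithinAt) fun r hr => ?_
  have hr' := interior_subset hr
  have hr0 : 0 < r := hr'.1
  have hd := (lt_Rend hr'.1 hr'.2).2
  rw [(hder r hr').deriv, neg_lt_zero]
  have hk := hK.2.2.1 r hr0
  have hKr := hK.1 r hr0
  refine mul_pos (div_pos (Real.rpow_pos_of_pos (by linarith) _) (mul_pos hr0 hKr)) ?_
  have hq : 0 < (p - 1) / p := div_pos (by linarith) (by linarith)
  have h1 := mul_pos hk hq
  have h2 : p * ((p - 1) / p) = p - 1 := mul_div_cancel₀ _ (by linarith)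
  nlinarith

/-- A solution starting above `u₀` with zero slope is initially decreasing. -/
theorem IsRadialSolution.Rend_pos (hu : IsRadialSolution p n K f (Ici 0) u) {u₀ : ℝ}
    (hu₀ : 0 < u₀) (hn : 2 ≤ n) (hK : CondK1 p K) (hf1 : CondF1 f u₀) (h0 : u₀ < u 0) :
    0 < Rend u := by
  obtain ⟨δ, hδ, hball⟩ : ∃ δ > 0, ∀ r ∈ Ico 0 δ, u₀ < u r := by
    have := (hu.2.2.1.continuousOn 0 self_mem_Ici).eventually_const_lt h0
    obtain ⟨δ, hδ, h⟩ := mem_nhdsGE_iff_exists_Ico_subset.1 this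
    exact ⟨δ, hδ, h⟩
  refine (ENNReal.ofReal_pos.2 hδ).trans_le (le_sSup fun t ht htδ => ?_)
  have htδ' : t < δ := (ENNReal.ofReal_lt_ofReal_iff hδ).1 htδ
  refine ⟨hu₀.trans (hball t ⟨ht.le, htδ'⟩), ?_⟩
  have hanti : StrictAntiOn (fun r => r ^ (n - 1) * phiP p (uderiv u r)) (Icc 0 t) := by
    refine strictAntiOn_of_deriv_neg (convex_Icc 0 t)
      (hu.2.2.2.1.continuousOn.mono Icc_subset_Ici_self) fun r hr => ?_
    rw [interior_Icc] at hr
    have hg : HasDerivAt (fun s => s ^ (n - 1) * phiP p (uderiv u s))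
        (-(r ^ (n - 1) * K r * f (u r))) r :=
      (hu.2.2.2.2 r hr.1.le hr.1).hasDerivAt (Ici_mem_nhds hr.1)
    rw [hg.deriv, neg_lt_zero]
    exact mul_pos (mul_pos (pow_pos hr.1 _) (hK.1 r hr.1))
      (hf1.2.1 _ (hball r ⟨hr.1.le, hr.2.trans htδ'⟩))
  have h := hanti (left_mem_Icc.2 ht.le) (right_mem_Icc.2 ht.le) ht
  simp only [zero_pow (show n - 1 ≠ 0 by omega), zero_mul] at h
  by_contra! hge
  exact absurd h (not_lt.2 (mul_nonneg (pow_pos ht _).le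
    (mul_nonneg (Real.rpow_nonneg (abs_nonneg _) _) hge)))

end Solution

/-- Under (K1) the function `r^p K(r)` is increasing. -/
theorem CondK1.monotoneOn_rpow_mul {p : ℝ} {K : ℝ → ℝ} (hK : CondK1 p K) :
    MonotoneOn (fun r => r ^ p * K r) (Ioi 0) := by
  have hder : ∀ r ∈ Ioi (0 : ℝ), HasDerivAt (fun r => r ^ p * K r)
      (p * r ^ (p - 1) * K r + r ^ p * deriv K r) r := fun r hr =>
    (Real.hasDerivAt_rpow_const (Or.inl (ne_of_gt hr))).mul
      ((hK.2.1.differentiableOn one_ne_zero).differentiableAt (Ioi_mem_nhds hr)).hasDerivAt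
  refine monotoneOn_of_deriv_nonneg (convex_Ioi 0)
    (fun r hr => (hder r hr).continuousAt.continuousWithinAt)
    (fun r hr => (hder r (interior_subset hr)).differentiableAt.differentiableWithinAt)
    fun r hr => ?_
  have hr0 : (0 : ℝ) < r := interior_subset hr
  rw [(hder r hr0).deriv]
  have hKr := hK.1 r hr0
  have h1 : r ^ p = r ^ (p - 1) * r := by
    rw [← Real.rpow_add_one hr0.ne']
    simp
  have h2 : p * r ^ (p - 1) * K r + r ^ p * deriv K r =
      r ^ (p - 1) * K r * (p + r * deriv K r / K r) := by
    rw [h1]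
    field_simp
  rw [h2]
  exact (mul_pos (mul_pos (Real.rpow_pos_of_pos hr0 _) hKr) (hK.2.2.1 r hr0)).le

/-- A function whose derivative is eventually at most `-c / r` is not bounded below. -/
theorem exists_neg_of_deriv_le {u u' : ℝ → ℝ} {a c : ℝ} (ha : 0 < a) (hc : 0 < c)
    (hu : ∀ r, a ≤ r → HasDerivAt u (u' r) r) (hle : ∀ r, a ≤ r → u' r ≤ -(c / r)) :
    ∃ r, a ≤ r ∧ u r < 0 := by
  have hder : ∀ r ∈ Ici a, HasDerivAt (fun r => u r + c * Real.log r) (u' r + c * r⁻¹) r :=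
    fun r hr => (hu r hr).add ((Real.hasDerivAt_log (ha.trans_le hr).ne').const_mul c)
  have hanti : AntitoneOn (fun r => u r + c * Real.log r) (Ici a) := by
    refine antitoneOn_of_deriv_nonpos (convex_Ici a)
      (fun r hr => (hder r hr).continuousAt.continuousWithinAt)
      (fun r hr => (hder r (interior_subset hr)).differentiableAt.differentiableWithinAt)
      fun r hr => ?_
    rw [(hder r (interior_subset hr)).deriv]
    have := hle r (interior_subset hr)
    rw [div_eq_mul_inv] at this
    linarith
  have hlog : Tendsto (fun r => c * Real.log r) atTop atTop :=
    Real.tendsto_log_atTop.const_mul_atTop hc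
  obtain ⟨r, hr, har⟩ := ((hlog.eventually_gt_atTop (u a + c * Real.log a)).and
    (eventually_ge_atTop a)).exists
  have h := hanti self_mem_Ici har har
  exact ⟨r, har, by simp only at h; linarith⟩

section Limits

variable {p : ℝ} {n : ℕ} {K f u : ℝ → ℝ}

theorem Fint_comp_tendsto_zero (hf : ContinuousOn f (Ici 0)) (hR : 0 < Rend u)
    (hlim : Tendsto u (endFilter (Rend u)) (𝓝 0)) :
    Tendsto (fun r => Fint f (u r)) (endFilter (Rend u)) (𝓝 0) := by
  refine (Fint_tendsto_zero hf).comp (tendsto_nhdsWithin_iff.2 ⟨hlim, ?_⟩)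
  filter_upwards [eventually_endFilter le_rfl (by simpa using hR)] with s hs
  exact (lt_Rend hs.1 hs.2).1

theorem IsRadialSolution.radialEnergy_pos (hu : IsRadialSolution p n K f (Ici 0) u)
    (hp : 1 < p) (hn : p < n) (hK : CondK1 p K) (hf : ContinuousOn f (Ici 0))
    (hlim : Tendsto u (endFilter (Rend u)) (𝓝 0)) {r : ℝ} (hr : 0 < r)
    (hrR : ENNReal.ofReal r < Rend u) : 0 < radialEnergy p K f u r := by
  have := endFilter_neBot (Rend u)
  have hanti := hu.radialEnergy_strictAntiOn hp hn hK hf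
  obtain ⟨t, hrt, htR⟩ := (eventually_endFilter hr.le hrR).exists
  have ht : 0 < t := hr.trans hrt
  refine lt_of_le_of_lt (le_of_tendsto
    (Fint_comp_tendsto_zero hf (bot_le.trans_lt hrR) hlim) ?_) (hanti ⟨hr, hrR⟩ ⟨ht, htR⟩ hrt)
  filter_upwards [eventually_endFilter ht.le htR] with s hs
  have hs0 : 0 < s := ht.trans hs.1
  refine le_trans ?_ (hanti ⟨ht, htR⟩ ⟨hs0, hs.2⟩ hs.1).le
  have hnn : 0 ≤ |uderiv u s| ^ p / ((p / (p - 1)) * K s) :=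
    div_nonneg (Real.rpow_nonneg (abs_nonneg _) _)
      (mul_nonneg (div_nonneg (by linarith) (by linarith)) (hK.1 s hs0).le)
  exact le_add_of_nonneg_left hnn

theorem IsRadialSolution.radialEnergy_tendsto_zero_of_eq_top
    (hu : IsRadialSolution p n K f (Ici 0) u)
    (hp : 1 < p) (hn : p < n) (hK : CondK1 p K) (hf : ContinuousOn f (Ici 0))
    (hR : Rend u = ⊤) (hlim : Tendsto u atTop (𝓝 0)) :
    Tendsto (radialEnergy p K f u) atTop (𝓝 0) := by
  have hlt : ∀ r, ENNReal.ofReal r < Rend u := fun r => hR ▸ ENNReal.ofReal_lt_top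
  have hend : endFilter (Rend u) = atTop := by simp [endFilter, hR]
  have hanti := hu.radialEnergy_strictAntiOn hp hn hK hf
  have hF : Tendsto (fun r => Fint f (u r)) atTop (𝓝 0) := by
    have := Fint_comp_tendsto_zero hf (hR ▸ ENNReal.zero_lt_top) (hend.symm ▸ hlim)
    rwa [hend] at this
  have hpos : ∀ r, 0 < r → 0 < radialEnergy p K f u r := fun r hr =>
    hu.radialEnergy_pos hp hn hK hf (hend.symm ▸ hlim) hr (hlt r)
  refine Metric.tendsto_atTop.2 fun ε hε => ?_
  by_contra! hcon
  have hge : ∀ r, 0 < r → ε ≤ radialEnergy p K f u r := by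
    intro r hr
    obtain ⟨s, hrs, hs⟩ := hcon r
    have hs0 := hr.trans_le hrs
    rw [Real.dist_eq, sub_zero, abs_of_pos (hpos s hs0)] at hs
    exact hs.trans (hanti.antitoneOn ⟨hr, hlt r⟩ ⟨hs0, hlt s⟩ hrs)
  obtain ⟨a, ha⟩ := eventually_atTop.1 ((hF.eventually_lt_const (half_pos hε)).and
    (eventually_ge_atTop 1))
  have ha1 : 1 ≤ a := (ha a le_rfl).2
  have hq : 0 < p / (p - 1) := div_pos (by linarith) (by linarith)
  have hK1 := hK.1 1 one_pos
  set b : ℝ := ε / 2 * (p / (p - 1) * K 1) with hb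
  have hb0 : 0 < b := by positivity
  obtain ⟨r, har, hr⟩ := exists_neg_of_deriv_le (u := u) (u' := uderiv u) (a := a)
    (c := b ^ p⁻¹) (by linarith) (Real.rpow_pos_of_pos hb0 _)
    (fun r hr => hu.hasDerivAt (by linarith)) fun r hr => by
      have hr0 : 0 < r := by linarith
      have hd := (lt_Rend hr0 (hlt r)).2
      have hKr := hK.1 r hr0
      have hmono : K 1 ≤ r ^ p * K r := by
        simpa using hK.monotoneOn_rpow_mul (mem_Ioi.2 one_pos) (mem_Ioi.2 hr0)
          (show (1 : ℝ) ≤ r by linarith)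
      have hE : ε / 2 ≤ (-uderiv u r) ^ p / ((p / (p - 1)) * K r) := by
        have h1 := hge r hr0
        have h2 := (ha r hr).1
        rw [radialEnergy, abs_of_neg hd] at h1
        linarith
      rw [le_div_iff₀ (mul_pos hq hKr)] at hE
      have hbp : b ≤ (-uderiv u r * r) ^ p := by
        rw [Real.mul_rpow (by linarith) hr0.le]
        calc b ≤ ε / 2 * (p / (p - 1) * (r ^ p * K r)) := by rw [hb]; gcongr
          _ = ε / 2 * (p / (p - 1) * K r) * r ^ p := by ring
          _ ≤ (-uderiv u r) ^ p * r ^ p := by gcongr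
      have hroot : b ^ p⁻¹ ≤ -uderiv u r * r :=
        (Real.rpow_inv_le_iff_of_pos hb0.le (mul_nonneg (by linarith) hr0.le)
          (by linarith)).2 hbp
      have := (div_le_iff₀ hr0).2 hroot
      linarith
  exact absurd hr (not_lt.2 (lt_Rend (by linarith) (hlt r)).1.le)

theorem radialEnergy_tendsto_zero_of_ne_top (hp : 1 < p) (hK : CondK1 p K)
    (hf : ContinuousOn f (Ici 0)) (hR0 : 0 < Rend u) (hR : Rend u ≠ ⊤)
    (hlim : Tendsto u (endFilter (Rend u)) (𝓝 0))
    (hlim' : Tendsto (uderiv u) (endFilter (Rend u)) (𝓝 0)) :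
    Tendsto (radialEnergy p K f u) (endFilter (Rend u)) (𝓝 0) := by
  have hRpos : 0 < (Rend u).toReal := ENNReal.toReal_pos hR0.ne' hR
  have hKc : Tendsto K (endFilter (Rend u)) (𝓝 (K (Rend u).toReal)) := by
    simp only [endFilter, hR, if_false]
    exact (hK.2.1.continuousOn.continuousAt (Ioi_mem_nhds hRpos)).tendsto.mono_left
      nhdsWithin_le_nhds
  have hq : 0 < p / (p - 1) := div_pos (by linarith) (by linarith)
  have h1 := hlim'.abs.rpow_const (p := p) (Or.inr (by linarith))
  have h2 := (h1.div (hKc.const_mul (p / (p - 1)))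
    (mul_pos hq (hK.1 _ hRpos)).ne').add (Fint_comp_tendsto_zero hf hR0 hlim)
  rw [abs_zero, Real.zero_rpow (by linarith), zero_div, zero_add] at h2
  exact h2

end Limits

/-- For `ᾱ ∈ G ∪ N` the energy is strictly positive on `(0,R(ᾱ))`, and for
`ᾱ ∈ G` the energy tends to `0` at `R(ᾱ)`. -/
theorem energy_positive_on_ground_or_crossing
    (p : ℝ) (n : ℕ) (hp : 1 < p) (hn : p < n)
    (K f : ℝ → ℝ) (u₀ : ℝ) (hu₀ : 0 < u₀)
    (hK : CondK1 p K) (hf1 : CondF1 f u₀) (hf2 : CondF2 f u₀)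
    (u : ℝ → ℝ → ℝ) (hfam : IsFamily p n K f u₀ u)
    (uR : ℝ → ℝ)
    (huR : ∀ α : ℝ, u₀ < α → Tendsto (u α) (endFilter (Rend (u α))) (𝓝 (uR α)))
    (ᾱ : ℝ) (hᾱ : ᾱ ∈ Gset u uR u₀ ∪ Ncross u uR u₀) :
    (∀ r : ℝ, 0 < r → ENNReal.ofReal r < Rend (u ᾱ) →
      0 < |uderiv (u ᾱ) r| ^ p / ((p / (p - 1)) * K r) + Fint f (u ᾱ r)) ∧
    (ᾱ ∈ Gset u uR u₀ →
      Tendsto (fun r => |uderiv (u ᾱ) r| ^ p / ((p / (p - 1)) * K r) + Fint f (u ᾱ r))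
        (endFilter (Rend (u ᾱ))) (𝓝 0)) := by
  have hmem : u₀ < ᾱ ∧ uR ᾱ = 0 := hᾱ.elim (fun h => ⟨h.1, h.2.1⟩) fun h => ⟨h.1, h.2.1⟩
  obtain ⟨hα, huR0⟩ := hmem
  obtain ⟨hsol, hinit, -⟩ := hfam.1 ᾱ hα
  have hlim : Tendsto (u ᾱ) (endFilter (Rend (u ᾱ))) (𝓝 0) := huR0 ▸ huR ᾱ hα
  refine ⟨fun r hr hrR => hsol.radialEnergy_pos hp hn hK hf2.1 hlim hr hrR, fun hG => ?_⟩
  change Tendsto (radialEnergy p K f (u ᾱ)) _ _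
  by_cases hR : Rend (u ᾱ) = ⊤
  · have hend : endFilter (Rend (u ᾱ)) = atTop := by simp [endFilter, hR]
    rw [hend] at hlim ⊢
    exact hsol.radialEnergy_tendsto_zero_of_eq_top hp hn hK hf2.1 hR hlim
  · have hn2 : 2 ≤ n := by
      have : (1 : ℝ) < n := hp.trans hn
      exact_mod_cast this
    exact radialEnergy_tendsto_zero_of_ne_top hp hK hf2.1
      (hsol.Rend_pos hu₀ hn2 hK hf1 (hinit.symm ▸ hα)) hR hlim hG.2.2
end
end

section
/- Let p>1 and u₀>0, and let f:[u₀,∞)→ℝ be locally Lipschitz continuous (hence differentiable almost everywhere; D denotes its set of differentiability points) and satisfy (p-1)·f(u) ≤ f'(u)·(u-u₀) for every u ∈ D. Then, with F₀(s) = ∫_{u₀}^s f(t)dt, one has p·F₀(u) ≤ f(u)·(u-u₀) for every u ≥ u₀. -/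
open Set Filter Topology MeasureTheory
open scoped ENNReal NNReal

noncomputable section

/-- Relation (3.7): if `(p-1)f(u) ≤ f'(u)(u-u₀)` on the differentiability set of
the locally Lipschitz function `f`, then `p·F₀(u) ≤ f(u)(u-u₀)` for `u ≥ u₀`,
where `F₀(s)=∫_{u₀}^s f`. -/
theorem pF0_le
    (p : ℝ) (hp : 1 < p) (u₀ : ℝ) (hu₀ : 0 < u₀)
    (f : ℝ → ℝ) (hlip : LocallyLipschitzOn (Ici u₀) f)
    (hf3 : ∀ v ∈ Dset f u₀, (p - 1) * f v ≤ fder f u₀ v * (v - u₀)) :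
    ∀ v : ℝ, u₀ ≤ v → p * ∫ t in u₀..v, f t ≤ f v * (v - u₀) := by
  intro v hv
  have hsub : uIcc u₀ v ⊆ Ici u₀ := by
    rw [uIcc_of_le hv]
    exact Icc_subset_Ici_self
  obtain ⟨K, hK⟩ := (hlip.mono hsub).exists_lipschitzOnWith_of_compact isCompact_uIcc
  have hf : AbsolutelyContinuousOnInterval f u₀ v := hK.absolutelyContinuousOnInterval
  have hg : AbsolutelyContinuousOnInterval (fun x => x - u₀) u₀ v :=
    (contDiff_id.sub contDiff_const).contDiffOn.absolutelyContinuousOnInterval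
  have hparts := hf.integral_deriv_mul_eq_sub hg
  simp only [deriv_sub_const, deriv_id'', sub_self, mul_zero, sub_zero, mul_one] at hparts
  have hint : IntervalIntegrable f volume u₀ v := hf.continuousOn.intervalIntegrable
  rw [← hparts, ← intervalIntegral.integral_const_mul]
  refine intervalIntegral.integral_mono_ae_restrict hv (hint.const_mul p)
    ((hf.intervalIntegrable_deriv.mul_continuousOn hg.continuousOn).add hint) ?_
  rw [Filter.EventuallyLE, ae_restrict_iff' measurableSet_Icc]
  filter_upwards [hf.ae_differentiableAt] with x hdiff hx
  have hx' : DifferentiableAt ℝ f x := hdiff (by rwa [uIcc_of_le hv])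
  have hle := hf3 x ⟨hx.1, hx'.differentiableWithinAt⟩
  rw [fder, hx'.derivWithin (uniqueDiffOn_Ici u₀ x hx.1)] at hle
  linarith
end
end
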